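/- Let R be a semidistributive left nearring with a multiplicative identity having no elements of additive order 2 (i.e., 2·x = 0 implies x = 0). Then the right distributive law (r+s)·t = r·t + s·t holds for all r, s, t ∈ R, so R is an associative ring. -/

import Mathlib

/-- A left nearring: `(R,+)` is a (not necessarily abelian) group, `(R,·)` is a
semigroup, and the left distributive law `x·(y+z) = x·y + x·z` holds. -/
class LeftNearring (R : Type*) extends AddGroup R, Semigroup R where
  left_distrib : ∀ x y z : R, x * (y + z) = x * y + x * z

/-- A left nearring with a multiplicative identity, i.e. `(R,·)` is a monoid. -/
class LeftNearringWithOne (R : Type*) extends LeftNearring R, Monoid R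

section Semidistributive

variable {R : Type*} [LeftNearringWithOne R]

theorem LeftNearringWithOne.zero_mul_of_semidistrib
    (hsd : ∀ r s t : R, (r + s + r) * t = r * t + s * t + r * t)
    (h2 : ∀ x : R, 2 • x = 0 → x = 0) (t : R) : 0 * t = 0 := by
  have h := hsd 0 0 t
  simp only [add_zero] at h
  apply h2
  rw [two_nsmul]
  exact add_eq_right.mp h.symm

theorem LeftNearringWithOne.neg_mul_of_semidistrib
    (hsd : ∀ r s t : R, (r + s + r) * t = r * t + s * t + r * t) (r t : R) :
    -r * t = -(r * t) := by
  have h := hsd r (-r) t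
  rw [add_neg_cancel, zero_add] at h
  exact (neg_eq_of_add_eq_zero_right (add_eq_right.mp h.symm)).symm

theorem LeftNearringWithOne.add_comm_of_semidistrib
    (hsd : ∀ r s t : R, (r + s + r) * t = r * t + s * t + r * t) (a b : R) :
    a + b = b + a := by
  have h := LeftNearring.left_distrib (-1 : R) a b
  simp only [neg_mul_of_semidistrib hsd, one_mul] at h
  rw [← neg_inj, h, neg_add_rev]

end Semidistributive

/-- A semidistributive left nearring with identity having no elements of
additive order `2` satisfies the right distributive law, hence is an
associative ring. -/
theorem stmt18 (R : Type*) [LeftNearringWithOne R]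
    (hsd : ∀ r s t : R, (r + s + r) * t = r * t + s * t + r * t)
    (h2 : ∀ x : R, 2 • x = 0 → x = 0) :
    (∀ r s t : R, (r + s) * t = r * t + s * t) ∧
      (∀ a b : R, a + b = b + a) := by
  have comm := LeftNearringWithOne.add_comm_of_semidistrib hsd
  refine ⟨fun r s t => ?_, comm⟩
  let : AddCommGroup R := { (inferInstance : AddGroup R) with add_comm := comm }
  have hdouble : ∀ x : R, (x + x) * t = x * t + x * t := fun x => by
    simpa [LeftNearringWithOne.zero_mul_of_semidistrib hsd h2] using hsd x 0 t
  have hsum : (r + s) * t + (r + s) * t = (r * t + s * t) + (r * t + s * t) := by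
    rw [← hdouble, show r + s + (r + s) = r + (s + s) + r by abel, hsd, hdouble]
    abel
  refine sub_eq_zero.mp (h2 _ ?_)
  rw [nsmul_sub, two_nsmul, two_nsmul, hsum, sub_self]
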